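/- arXiv:cs/0203013 — 8 statements merged into one kernel-verified Lean document; each statement's English description precedes it below -/
import Mathlib

section
/- The transitive closure of a modular binary relation is modular. That is, if ≤ is a relation on a set Ω such that for all x, y, z ∈ Ω, x ≤ y implies x ≤ z or z ≤ y, then the transitive closure ≤⁺ of ≤ also satisfies: for all x, y, z ∈ Ω, x ≤⁺ y implies x ≤⁺ z or z ≤⁺ y. -/
/-- The transitive closure of a modular relation is modular. -/
theorem transClosure_modular {Ω : Type*} (r : Ω → Ω → Prop)
    (hmod : ∀ x y z : Ω, r x y → r x z ∨ r z y) :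
    ∀ x y z : Ω, Relation.TransGen r x y →
      Relation.TransGen r x z ∨ Relation.TransGen r z y := by
  intro x y z h
  cases h with
  | single h => exact (hmod x y z h).imp .single .single
  | tail hxb hby => exact (hmod _ y z hby).imp (fun h => hxb.tail h) .single
end

section
/- Let ≤ be a binary relation on a finite set Ω, and for each subset X ⊆ Ω let C(X, ≤) = {x ∈ X : there is no x' ∈ X with x' < x}, where < is the strict version of ≤. Then C(X, ≤) is nonempty for every nonempty subset X ⊆ Ω if and only if ≤ is acyclic. -/
/-- For a relation `≤` on a finite set `Ω` with strict version `<`, the choice set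
`C(X, ≤) = {x ∈ X : ¬∃ x' ∈ X, x' < x}` is nonempty for every nonempty `X ⊆ Ω`
iff `≤` is acyclic. -/
theorem choiceSet_nonempty_iff_acyclic {Ω : Type*} [Fintype Ω] (le : Ω → Ω → Prop)
    (lt : Ω → Ω → Prop) (hlt : ∀ x y, lt x y ↔ le x y ∧ ¬ le y x) :
    (∀ X : Set Ω, X.Nonempty → {x ∈ X | ¬ ∃ x' ∈ X, lt x' x}.Nonempty) ↔
      (∀ (n : ℕ) (w : ℕ → Ω), (∀ i, i < n → lt (w i) (w (i + 1))) → ¬ lt (w n) (w 0)) := by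
  constructor
  · intro h n w hw hn
    obtain ⟨x, ⟨i, hi, rfl⟩, hx⟩ := h {x | ∃ i, i ≤ n ∧ w i = x} ⟨w 0, 0, Nat.zero_le _, rfl⟩
    apply hx
    cases i with
    | zero => exact ⟨w n, ⟨n, le_rfl, rfl⟩, hn⟩
    | succ k => exact ⟨w k, ⟨k, by omega, rfl⟩, hw k (by omega)⟩
  · intro h X hX
    by_contra hne
    have key : ∀ x : X, ∃ y : X, lt y x := by
      intro x
      by_contra hx
      exact hne ⟨x, x.2, fun ⟨y, hy, hyx⟩ => hx ⟨⟨y, hy⟩, hyx⟩⟩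
    choose f hf using key
    obtain ⟨x0, hx0⟩ := hX
    let u : ℕ → Ω := fun k => (f^[k] ⟨x0, hx0⟩ : X)
    have hu : ∀ k, lt (u (k + 1)) (u k) := by
      intro k
      simp only [u, Function.iterate_succ_apply']
      exact hf _
    have main : ∀ i j, i < j → u i ≠ u j := by
      intro i j hij he
      refine h (j - i - 1) (fun k => u (j - k)) ?_ ?_
      · intro k hk
        have := hu (j - (k + 1))
        rw [show j - (k + 1) + 1 = j - k by omega] at this
        exact this
      · have := hu i
        rw [he] at this
        simpa [show j - (j - i - 1) = i + 1 by omega] using this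
    obtain ⟨i, j, hij, he⟩ := Finite.exists_ne_map_eq_of_infinite u
    rcases lt_or_gt_of_ne hij with hl | hl
    · exact main i j hl he
    · exact main j i hl he.symm
end

section
/- (Arrow's Impossibility Theorem) Let Ω be a finite set with at least three elements and let n ≥ 2. There is no function f that maps every n-tuple (⪯₁, …, ⪯ₙ) of total pre-orders on Ω to a total pre-order ⪯ = f(⪯₁, …, ⪯ₙ) on Ω and satisfies all of: (Pareto) if x ≺ᵢ y for all i, then x ≺ y, where ≺ᵢ and ≺ denote strict versions; (Independence of Irrelevant Alternatives) if (⪯₁', …, ⪯ₙ') is another n-tuple with ⪯' = f(⪯₁', …, ⪯ₙ'), and for a pair x, y ∈ Ω one has x ⪯ᵢ y iff x ⪯ᵢ' y and y ⪯ᵢ x iff y ⪯ᵢ' x for all i, then x ⪯ y iff x ⪯' y and y ⪯ x iff y ⪯' x; (Non-Dictatorship) there is no index i such that for every n-tuple in the domain and every x, y ∈ Ω, x ≺ᵢ y implies x ≺ y. -/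
/-- A total pre-order: a total and transitive binary relation. -/
def TotalPreorderRel {Ω : Type*} (r : Ω → Ω → Prop) : Prop :=
  (∀ x y : Ω, r x y ∨ r y x) ∧ (∀ x y z : Ω, r x y → r y z → r x z)

/-- The strict version of a relation. -/
def StrictVer {Ω : Type*} (r : Ω → Ω → Prop) (x y : Ω) : Prop :=
  r x y ∧ ¬ r y x

/-- The profile given by utility functions. -/
def ofUtil {Ω : Type*} {n : ℕ} (u : Fin n → Ω → ℕ) : Fin n → Ω → Ω → Prop :=
  fun i a b => u i a ≤ u i b

theorem ofUtil_total {Ω : Type*} {n : ℕ} (u : Fin n → Ω → ℕ) (i : Fin n) :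
    TotalPreorderRel (ofUtil u i) :=
  ⟨fun x y => le_total (u i x) (u i y), fun _ _ _ h1 h2 => le_trans h1 h2⟩

/-- The first three axioms for a social welfare function. -/
structure IsSWF {Ω : Type*} {n : ℕ} (f : (Fin n → Ω → Ω → Prop) → (Ω → Ω → Prop)) : Prop where
  range : ∀ P : Fin n → Ω → Ω → Prop, (∀ i, TotalPreorderRel (P i)) → TotalPreorderRel (f P)
  pareto : ∀ P : Fin n → Ω → Ω → Prop, (∀ i, TotalPreorderRel (P i)) →
        ∀ x y : Ω, (∀ i, StrictVer (P i) x y) → StrictVer (f P) x y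
  iia : ∀ P P' : Fin n → Ω → Ω → Prop, (∀ i, TotalPreorderRel (P i)) →
        (∀ i, TotalPreorderRel (P' i)) →
        ∀ x y : Ω,
          (∀ i, (P i x y ↔ P' i x y) ∧ (P i y x ↔ P' i y x)) →
          ((f P x y ↔ f P' x y) ∧ (f P y x ↔ f P' y x))

/-- `S` is decisive for `x` against `y`. -/
def Decis {Ω : Type*} {n : ℕ} (f : (Fin n → Ω → Ω → Prop) → (Ω → Ω → Prop))
    (S : Finset (Fin n)) (x y : Ω) : Prop :=
  ∀ P : Fin n → Ω → Ω → Prop, (∀ i, TotalPreorderRel (P i)) →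
    (∀ i ∈ S, StrictVer (P i) x y) → StrictVer (f P) x y

/-- `S` is weakly decisive for `x` against `y`. -/
def WDecis {Ω : Type*} {n : ℕ} (f : (Fin n → Ω → Ω → Prop) → (Ω → Ω → Prop))
    (S : Finset (Fin n)) (x y : Ω) : Prop :=
  ∀ P : Fin n → Ω → Ω → Prop, (∀ i, TotalPreorderRel (P i)) →
    (∀ i ∈ S, StrictVer (P i) x y) → (∀ i, i ∉ S → StrictVer (P i) y x) → StrictVer (f P) x y

theorem Decis.weak {Ω : Type*} {n : ℕ} {f : (Fin n → Ω → Ω → Prop) → (Ω → Ω → Prop)}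
    {S : Finset (Fin n)} {x y : Ω} (h : Decis f S x y) : WDecis f S x y :=
  fun P hP h1 _ => h P hP h1

theorem strict_trans {Ω : Type*} {r : Ω → Ω → Prop} (h : TotalPreorderRel r) {x y z : Ω}
    (h1 : StrictVer r x y) (h2 : StrictVer r y z) : StrictVer r x z :=
  ⟨h.2 _ _ _ h1.1 h2.1, fun h3 => h1.2 (h.2 _ _ _ h2.1 h3)⟩

section
variable {Ω : Type*} {n : ℕ} {f : (Fin n → Ω → Ω → Prop) → (Ω → Ω → Prop)}

theorem expand_right (hf : IsSWF f) {S : Finset (Fin n)} {x y z : Ω} (hxy : x ≠ y)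
    (hzx : z ≠ x) (hzy : z ≠ y) (h : WDecis f S x y) : Decis f S x z := by
  classical
  intro P hP hS
  let u : Fin n → Ω → ℕ := fun i w =>
    if w = y then (if i ∈ S then 2 else 0) else
    if w = x then (if P i z x then 3 else 1) else (if P i x z then 3 else 1)
  have ux : ∀ i, u i x = if P i z x then 3 else 1 := fun i => by simp [u, hxy]
  have uy : ∀ i, u i y = if i ∈ S then 2 else 0 := fun i => by simp [u]
  have uz : ∀ i, u i z = if P i x z then 3 else 1 := fun i => by simp [u, hzx, hzy]
  have hQ := ofUtil_total u
  have h1 : StrictVer (f (ofUtil u)) x y := by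
    apply h _ hQ
    · intro i hi
      have := hS i hi
      simp only [StrictVer, ofUtil, ux, uy] at this ⊢
      grind
    · intro i hi
      simp only [StrictVer, ofUtil, ux, uy]
      grind
  have h2 : StrictVer (f (ofUtil u)) y z := by
    apply hf.pareto _ hQ
    intro i
    have := hS i
    simp only [StrictVer, ofUtil, uz, uy] at this ⊢
    grind
  have h3 := strict_trans (hf.range _ hQ) h1 h2
  have h4 := hf.iia P (ofUtil u) hP hQ x z (by
    intro i
    have := (hP i).1 x z
    simp only [ofUtil, ux, uz]
    grind)
  exact ⟨h4.1.2 h3.1, fun h => h3.2 (h4.2.1 h)⟩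

theorem expand_left (hf : IsSWF f) {S : Finset (Fin n)} {x y z : Ω} (hxy : x ≠ y)
    (hzx : z ≠ x) (hzy : z ≠ y) (h : WDecis f S x y) : Decis f S z y := by
  classical
  intro P hP hS
  let u : Fin n → Ω → ℕ := fun i w =>
    if w = x then (if i ∈ S then 2 else 4) else
    if w = y then (if P i z y then 3 else 1) else (if P i y z then 3 else 1)
  have ux : ∀ i, u i x = if i ∈ S then 2 else 4 := fun i => by simp [u]
  have uy : ∀ i, u i y = if P i z y then 3 else 1 := fun i => by simp [u, hxy.symm]
  have uz : ∀ i, u i z = if P i y z then 3 else 1 := fun i => by simp [u, hzx, hzy]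
  have hQ := ofUtil_total u
  have h1 : StrictVer (f (ofUtil u)) x y := by
    apply h _ hQ
    · intro i hi
      have := hS i hi
      simp only [StrictVer, ofUtil, ux, uy] at this ⊢
      grind
    · intro i hi
      simp only [StrictVer, ofUtil, ux, uy]
      grind
  have h2 : StrictVer (f (ofUtil u)) z x := by
    apply hf.pareto _ hQ
    intro i
    have := hS i
    simp only [StrictVer, ofUtil, uz, ux] at this ⊢
    grind
  have h3 := strict_trans (hf.range _ hQ) h2 h1
  have h4 := hf.iia P (ofUtil u) hP hQ z y (by
    intro i
    have := (hP i).1 z y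
    simp only [ofUtil, uy, uz]
    grind)
  exact ⟨h4.1.2 h3.1, fun h => h3.2 (h4.2.1 h)⟩

theorem expand_all (hf : IsSWF f) (h3 : ∀ a b : Ω, ∃ c, c ≠ a ∧ c ≠ b)
    {S : Finset (Fin n)} {x y : Ω} (hxy : x ≠ y)
    (h : WDecis f S x y) (a b : Ω) (hab : a ≠ b) : Decis f S a b := by
  have R : ∀ x y b : Ω, x ≠ y → WDecis f S x y → b ≠ x → Decis f S x b := by
    intro x y b hxy h hb
    by_cases hby : b = y
    · subst hby
      obtain ⟨c, hc1, hc2⟩ := h3 x b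
      exact expand_right hf hc1.symm hb hc2.symm (expand_right hf hxy hc1 hc2 h).weak
    · exact expand_right hf hxy hb hby h
  have L : ∀ x y a : Ω, x ≠ y → WDecis f S x y → a ≠ y → Decis f S a y := by
    intro x y a hxy h ha
    by_cases hax : a = x
    · subst hax
      obtain ⟨c, hc1, hc2⟩ := h3 a y
      exact expand_left hf hc2 hc1.symm ha (expand_left hf hxy hc1 hc2 h).weak
    · exact expand_left hf hxy hax ha h
  by_cases hb : b = x
  · subst hb
    obtain ⟨c, hc1, hc2⟩ := h3 a b
    exact R a c b hc1.symm
      (L b c a hc2.symm (R b y c hxy h hc2).weak hc1.symm).weak hab.symm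
  · exact L x b a (Ne.symm hb) (R x y b hxy h hb).weak hab

/-- A weak decisiveness criterion: a single profile suffices. -/
theorem wdecis_of_one (hf : IsSWF f) {S : Finset (Fin n)} {x y : Ω}
    {Q : Fin n → Ω → Ω → Prop} (hQ : ∀ i, TotalPreorderRel (Q i))
    (h1 : ∀ i ∈ S, StrictVer (Q i) x y) (h2 : ∀ i, i ∉ S → StrictVer (Q i) y x)
    (h : StrictVer (f Q) x y) : WDecis f S x y := by
  intro P hP g1 g2
  have h4 := hf.iia P Q hP hQ x y (by
    intro i
    by_cases hi : i ∈ S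
    · have a := h1 i hi
      have b := g1 i hi
      simp only [StrictVer] at a b
      tauto
    · have a := h2 i hi
      have b := g2 i hi
      simp only [StrictVer] at a b
      tauto)
  exact ⟨h4.1.2 h.1, fun h' => h.2 (h4.2.1 h')⟩

theorem contract (hf : IsSWF f) (h3 : ∀ a b : Ω, ∃ c, c ≠ a ∧ c ≠ b) {x y : Ω} (hxy : x ≠ y) :
    ∀ S : Finset (Fin n), (∀ a b : Ω, a ≠ b → Decis f S a b) →
      ∃ i, ∀ a b : Ω, a ≠ b → Decis f {i} a b := by
  classical
  intro S
  induction S using Finset.induction_on with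
  | empty =>
    intro h
    have hQ := ofUtil_total (fun (_ : Fin n) (_ : Ω) => 0)
    have h1 := h x y hxy _ hQ (by simp)
    have h2 := h y x hxy.symm _ hQ (by simp)
    exact absurd h2.1 h1.2
  | insert j S hj ih =>
    intro h
    obtain ⟨z, hzx, hzy⟩ := h3 x y
    let u : Fin n → Ω → ℕ := fun i w =>
      if i = j then (if w = x then 0 else if w = y then 1 else 2) else
      if i ∈ S then (if w = x then 1 else if w = y then 2 else 0) else
      (if w = x then 2 else if w = y then 0 else 1)
    have ux : ∀ i, u i x = if i = j then 0 else if i ∈ S then 1 else 2 :=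
      fun i => by simp [u]
    have uy : ∀ i, u i y = if i = j then 1 else if i ∈ S then 2 else 0 :=
      fun i => by simp [u, hxy.symm]
    have uz : ∀ i, u i z = if i = j then 2 else if i ∈ S then 0 else 1 :=
      fun i => by simp [u, hzx, hzy]
    have hQ := ofUtil_total u
    have h1 : StrictVer (f (ofUtil u)) x y := by
      apply h x y hxy _ hQ
      intro i hi
      simp only [StrictVer, ofUtil, ux, uy]
      grind
    have hT := hf.range _ hQ
    by_cases hc : f (ofUtil u) z x
    · have h2 : StrictVer (f (ofUtil u)) z y :=
        ⟨hT.2 _ _ _ hc h1.1, fun h' => h1.2 (hT.2 _ _ _ h' hc)⟩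
      apply ih
      apply expand_all hf h3 hzy
      refine wdecis_of_one hf hQ ?_ ?_ h2
      · intro i hi
        simp only [StrictVer, ofUtil, uz, uy]
        grind
      · intro i hi
        simp only [StrictVer, ofUtil, uz, uy]
        grind
    · have h2 : StrictVer (f (ofUtil u)) x z := ⟨(hT.1 x z).resolve_right hc, hc⟩
      refine ⟨j, ?_⟩
      apply expand_all hf h3 hzx.symm
      refine wdecis_of_one hf hQ ?_ ?_ h2
      · intro i hi
        simp only [StrictVer, ofUtil, uz, ux]
        grind
      · intro i hi
        simp only [StrictVer, ofUtil, uz, ux]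
        grind
end

/-- Arrow's Impossibility Theorem: for `|Ω| ≥ 3` and `n ≥ 2` voters, there is no
aggregation function on total pre-orders satisfying restricted range, Pareto,
independence of irrelevant alternatives, and non-dictatorship. -/
theorem arrow_impossibility {Ω : Type*} [Fintype Ω] (hΩ : 3 ≤ Fintype.card Ω)
    (n : ℕ) (hn : 2 ≤ n) :
    ¬ ∃ f : (Fin n → Ω → Ω → Prop) → (Ω → Ω → Prop),
      -- restricted range (on the domain of total pre-order profiles)
      (∀ P : Fin n → Ω → Ω → Prop, (∀ i, TotalPreorderRel (P i)) →
        TotalPreorderRel (f P)) ∧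
      -- Pareto principle
      (∀ P : Fin n → Ω → Ω → Prop, (∀ i, TotalPreorderRel (P i)) →
        ∀ x y : Ω, (∀ i, StrictVer (P i) x y) → StrictVer (f P) x y) ∧
      -- independence of irrelevant alternatives
      (∀ P P' : Fin n → Ω → Ω → Prop, (∀ i, TotalPreorderRel (P i)) →
        (∀ i, TotalPreorderRel (P' i)) →
        ∀ x y : Ω,
          (∀ i, (P i x y ↔ P' i x y) ∧ (P i y x ↔ P' i y x)) →
          ((f P x y ↔ f P' x y) ∧ (f P y x ↔ f P' y x))) ∧
      -- non-dictatorship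
      (¬ ∃ i : Fin n, ∀ P : Fin n → Ω → Ω → Prop, (∀ j, TotalPreorderRel (P j)) →
        ∀ x y : Ω, StrictVer (P i) x y → StrictVer (f P) x y) := by
  classical
  rintro ⟨f, hr, hp, hi, hd⟩
  have hf : IsSWF f := ⟨hr, hp, hi⟩
  have h3 : ∀ a b : Ω, ∃ c, c ≠ a ∧ c ≠ b := by
    intro a b
    have hlt : ({a, b} : Finset Ω).card < (Finset.univ : Finset Ω).card := by
      have := Finset.card_le_two (a := a) (b := b)
      rw [Finset.card_univ]
      omega
    obtain ⟨c, _, hc⟩ := Finset.exists_mem_notMem_of_card_lt_card hlt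
    exact ⟨c, by simpa using hc⟩
  obtain ⟨x, y, hxy⟩ := Fintype.exists_pair_of_one_lt_card (α := Ω) (by omega)
  obtain ⟨i, h⟩ := contract hf h3 hxy Finset.univ
    (fun a b _ P hP hS => hp P hP a b (fun i => hS i (Finset.mem_univ i)))
  refine hd ⟨i, fun P hP a b hab => h a b ?_ P hP ?_⟩
  · rintro rfl
    exact hab.2 hab.1
  · intro j hj
    rw [Finset.mem_singleton] at hj
    exact hj ▸ hab
end

section
/- (Representation theorem for generalized belief states) Let ≺ be a binary relation on a finite set W. Then ≺ is modular and transitive if and only if there exists a function rk : W → ℕ such that: (1) for all x, y ∈ W with rk(x) ≠ rk(y), one has rk(x) < rk(y) iff x ≺ y; and (2) for each i ∈ ℕ, the level set W_i = {w ∈ W : rk(w) = i} is either fully connected (w ≺ w' for all w, w' ∈ W_i) or fully disconnected (¬(w ≺ w') for all w, w' ∈ W_i). -/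
/-- Representation theorem for generalized belief states: a relation `≺` on a
finite set `W` is modular and transitive iff there is a ranking `rk : W → ℕ`
such that worlds of distinct ranks are ordered by rank, and each level set is
either fully connected or fully disconnected. -/
theorem generalizedBeliefState_representation {W : Type*} [Fintype W]
    (prec : W → W → Prop) :
    ((∀ x y z : W, prec x y → prec x z ∨ prec z y) ∧
     (∀ x y z : W, prec x y → prec y z → prec x z)) ↔
    (∃ rk : W → ℕ,
      (∀ x y : W, rk x ≠ rk y → (rk x < rk y ↔ prec x y)) ∧
      (∀ i : ℕ,
        (∀ w w' : W, rk w = i → rk w' = i → prec w w') ∨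
        (∀ w w' : W, rk w = i → rk w' = i → ¬ prec w w'))) := by
  constructor
  · rintro ⟨hm, ht⟩
    classical
    let S : W → Finset W := fun x => Finset.univ.filter (fun z => prec z x ∧ ¬ prec x z)
    have hS : ∀ x z, z ∈ S x ↔ (prec z x ∧ ¬ prec x z) := by
      intro x z
      simp [S]
    have h1 : ∀ x y, (prec x y ∧ ¬ prec y x) → (S x).card < (S y).card := by
      intro x y h
      apply Finset.card_lt_card
      rw [Finset.ssubset_iff_of_subset]
      · refine ⟨x, (hS y x).2 h, ?_⟩
        rw [hS]
        tauto
      · intro z hz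
        rw [hS] at hz ⊢
        exact ⟨ht _ _ _ hz.1 h.1, fun hyz => h.2 (ht _ _ _ hyz hz.1)⟩
    have h2 : ∀ x y, (S x).card < (S y).card → (prec x y ∧ ¬ prec y x) := by
      intro x y h
      by_contra hn
      apply absurd h
      rw [not_lt]
      apply Finset.card_le_card
      intro z hz
      rw [hS] at hz ⊢
      have a := hm z y x hz.1
      have b := hm x z y
      have c := hm y x z
      have d := ht y x z
      have e := ht y z x
      have f := ht x z y
      have g := ht z x y
      have g' := ht x y z
      tauto
    have h3 : ∀ x y, (S x).card = (S y).card → (prec x y ↔ prec y x) := by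
      intro x y h
      have a := h1 x y
      have b := h1 y x
      constructor
      · intro p
        by_contra q
        have := a ⟨p, q⟩
        omega
      · intro p
        by_contra q
        have := b ⟨p, q⟩
        omega
    refine ⟨fun x => (S x).card, ?_, ?_⟩
    · intro x y hne
      refine ⟨fun h => (h2 x y h).1, fun p => ?_⟩
      rcases lt_or_gt_of_ne hne with h | h
      · exact h
      · exact absurd p (h2 y x h).2
    · intro i
      by_cases hr : ∃ x, (S x).card = i ∧ prec x x
      · left
        obtain ⟨x, hx, hxx⟩ := hr
        have key : ∀ w, (S w).card = i → prec w x ∧ prec x w := by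
          intro w hw
          have a := h3 w x (hw.trans hx.symm)
          have b := hm x x w hxx
          tauto
        intro w w' hw hw'
        exact ht _ _ _ (key w hw).1 (key w' hw').2
      · right
        intro w w' hw hw' p
        exact hr ⟨w, hw, ht _ _ _ p ((h3 w w' (hw.trans hw'.symm)).1 p)⟩
  · rintro ⟨rk, h1, h2⟩
    have h3 : ∀ x y, prec x y → rk x ≤ rk y := by
      intro x y p
      by_contra h
      have := (h1 x y (by omega)).2 p
      omega
    have h4 : ∀ x y, rk x < rk y → prec x y := fun x y h => (h1 x y (by omega)).1 h
    have h5 : ∀ x y a b, prec x y → rk x = rk y → rk a = rk x → rk b = rk x → prec a b := by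
      intro x y a b p e ea eb
      rcases h2 (rk x) with h | h
      · exact h a b ea eb
      · exact absurd p (h x y rfl e.symm)
    constructor
    · intro x y z p
      have := h3 x y p
      by_cases a : rk x < rk z
      · exact Or.inl (h4 _ _ a)
      by_cases b : rk z < rk y
      · exact Or.inr (h4 _ _ b)
      exact Or.inl (h5 x y x z p (by omega) rfl (by omega))
    · intro x y z p q
      have := h3 x y p
      have := h3 y z q
      by_cases a : rk x < rk z
      · exact h4 _ _ a
      exact h5 x y x z p (by omega) rfl (by omega)
end

section
/- Let S be a finite set of sources, each source s ∈ S having a belief state <^s that is a modular, transitive relation on a finite set W. Then AGRUn(S), the transitive closure of Un(S) = ⋃_{s ∈ S} <^s, is a modular, transitive relation on W (i.e., a generalized belief state). -/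
/-- `AGRUn(S)`, the transitive closure of the union of the sources' (modular,
transitive) belief states, is a generalized belief state: modular and transitive. -/
theorem AGRUn_is_beliefState {W : Type*} [Fintype W] {S : Type*} [Fintype S]
    (b : S → W → W → Prop)
    (hmod : ∀ s, ∀ x y z : W, b s x y → b s x z ∨ b s z y)
    (htrans : ∀ s, ∀ x y z : W, b s x y → b s y z → b s x z) :
    (∀ x y z : W, Relation.TransGen (fun u v => ∃ s, b s u v) x y →
        Relation.TransGen (fun u v => ∃ s, b s u v) x z ∨
        Relation.TransGen (fun u v => ∃ s, b s u v) z y) ∧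
    (∀ x y z : W, Relation.TransGen (fun u v => ∃ s, b s u v) x y →
        Relation.TransGen (fun u v => ∃ s, b s u v) y z →
        Relation.TransGen (fun u v => ∃ s, b s u v) x z) := by
  refine ⟨?_, fun x y z h1 h2 => h1.trans h2⟩
  intro x y z h
  induction h with
  | single h =>
    obtain ⟨s, hs⟩ := h
    rcases hmod s _ _ z hs with h | h
    · exact Or.inl (Relation.TransGen.single ⟨s, h⟩)
    · exact Or.inr (Relation.TransGen.single ⟨s, h⟩)
  | tail _ h ih =>
    rcases ih with ih | ih
    · exact Or.inl ih
    · exact Or.inr (ih.tail h)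
end

section
/- Let S be a finite set of sources, each s ∈ S with a belief state <^s that is a modular, transitive relation on a finite set W, and let rank : S → R assign each source a rank in a linearly ordered set R. Then the relation AGRRf(S) = {(x, y) : ∃ s ∈ S, x <^s y and for every s' ∈ S with rank(s') > rank(s), neither x <^{s'} y nor y <^{s'} x} is modular: for all x, y, z ∈ W, if (x, y) ∈ AGRRf(S), then (x, z) ∈ AGRRf(S) or (z, y) ∈ AGRRf(S). -/
/-- The refinement aggregation `AGRRf(S)`: `x` is related to `y` iff some source
believes `x <^s y` and every strictly higher-ranked source is agnostic about `x, y`. -/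
def AGRRf {W S R : Type*} [LinearOrder R] (b : S → W → W → Prop) (rank : S → R)
    (x y : W) : Prop :=
  ∃ s : S, b s x y ∧ ∀ s' : S, rank s < rank s' → ¬ b s' x y ∧ ¬ b s' y x

/-- `AGRRf(S)` is modular whenever every source's belief state is modular and
transitive. -/
theorem AGRRf_modular {W : Type*} [Fintype W] {S : Type*} [Fintype S]
    {R : Type*} [LinearOrder R] (b : S → W → W → Prop) (rank : S → R)
    (hmod : ∀ s, ∀ x y z : W, b s x y → b s x z ∨ b s z y)
    (htrans : ∀ s, ∀ x y z : W, b s x y → b s y z → b s x z) :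
    ∀ x y z : W, AGRRf b rank x y → AGRRf b rank x z ∨ AGRRf b rank z y := by
  classical
  rintro x y z ⟨s, hs, hag⟩
  let F : Finset S := Finset.univ.filter fun t =>
    rank s < rank t ∧ (b t x z ∨ b t z x ∨ b t z y ∨ b t y z)
  by_cases hF : F.Nonempty
  · obtain ⟨t, ht, hmax⟩ := Finset.exists_max_image F rank hF
    obtain ⟨hst, hor⟩ := (Finset.mem_filter.mp ht).2
    have hi : ∀ t', rank t < rank t' → ¬ (b t' x z ∨ b t' z x ∨ b t' z y ∨ b t' y z) := by
      intro t' h hc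
      have := hmax t' (Finset.mem_filter.mpr ⟨Finset.mem_univ _, hst.trans h, hc⟩)
      exact absurd h (not_lt.mpr this)
    have key : b t x z ∨ b t z y := by
      have hxy := hag t hst
      rcases hor with h | h | h | h
      · exact Or.inl h
      · exact Or.inr ((hmod t z x y h).resolve_right hxy.2)
      · exact Or.inr h
      · exact Or.inl ((hmod t y z x h).resolve_left hxy.2)
    rcases key with h | h
    · exact Or.inl ⟨t, h, fun t' h' => by have := hi t' h'; tauto⟩
    · exact Or.inr ⟨t, h, fun t' h' => by have := hi t' h'; tauto⟩
  · have hi : ∀ t', rank s < rank t' → ¬ (b t' x z ∨ b t' z x ∨ b t' z y ∨ b t' y z) := by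
      intro t' h hc
      exact hF ⟨t', Finset.mem_filter.mpr ⟨Finset.mem_univ _, h, hc⟩⟩
    rcases hmod s x y z hs with h | h
    · exact Or.inl ⟨s, h, fun t' h' => by have := hi t' h'; tauto⟩
    · exact Or.inr ⟨s, h, fun t' h' => by have := hi t' h'; tauto⟩
end

section
/- Let S be a finite set of sources, each s ∈ S with a belief state <^s that is a modular, transitive relation on a finite set W, and let rank : S → R be an injective rank function into a linearly ordered set R (so the sources are strictly ranked). Then AGRRf(S) = {(x, y) : ∃ s ∈ S, x <^s y and for every s' ∈ S with rank(s') > rank(s), neither x <^{s'} y nor y <^{s'} x} is modular and transitive, i.e., a generalized belief state on W. -/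
/-- If the sources are strictly ranked (the rank function is injective), then
`AGRRf(S)` is modular and transitive, i.e., a generalized belief state. -/
theorem AGRRf_strictlyRanked_beliefState {W : Type*} [Fintype W]
    {S : Type*} [Fintype S] {R : Type*} [LinearOrder R]
    (b : S → W → W → Prop) (rank : S → R) (hinj : Function.Injective rank)
    (hmod : ∀ s, ∀ x y z : W, b s x y → b s x z ∨ b s z y)
    (htrans : ∀ s, ∀ x y z : W, b s x y → b s y z → b s x z) :
    (∀ x y z : W, AGRRf b rank x y → AGRRf b rank x z ∨ AGRRf b rank z y) ∧
    (∀ x y z : W, AGRRf b rank x y → AGRRf b rank y z → AGRRf b rank x z) := by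
  refine ⟨?_, ?_⟩
  · rintro x y z ⟨s, hs, hab⟩
    classical
    let F : Finset S := Finset.univ.filter
      (fun t => b t x z ∨ b t z x ∨ b t z y ∨ b t y z)
    have hsF : s ∈ F := by
      have := hmod s x y z hs
      simp only [F, Finset.mem_filter, Finset.mem_univ, true_and]
      tauto
    obtain ⟨t, htF, hmax⟩ := Finset.exists_max_image F rank ⟨s, hsF⟩
    have habove : ∀ s', rank t < rank s' →
        ¬ (b s' x z ∨ b s' z x ∨ b s' z y ∨ b s' y z) := by
      intro s' hlt hc
      have : s' ∈ F := by simpa [F] using hc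
      exact absurd (hmax s' this) (not_le.mpr hlt)
    have hor : b t x z ∨ b t z y := by
      rcases (hmax s hsF).lt_or_eq with hlt | heq
      · have ht : b t x z ∨ b t z x ∨ b t z y ∨ b t y z := by simpa [F] using htF
        obtain ⟨h1, h2⟩ := hab t hlt
        rcases ht with h | h | h | h
        · exact Or.inl h
        · have := hmod t z x y h
          tauto
        · exact Or.inr h
        · have := hmod t y z x h
          tauto
      · obtain rfl := hinj heq
        exact hmod s x y z hs
    rcases hor with h | h
    · refine Or.inl ⟨t, h, fun s' hlt => ?_⟩
      have := habove s' hlt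
      tauto
    · refine Or.inr ⟨t, h, fun s' hlt => ?_⟩
      have := habove s' hlt
      tauto
  · rintro x y z ⟨s, hs, has⟩ ⟨t, ht, hat⟩
    have key : ∀ s', rank s < rank s' → rank t < rank s' → ¬ b s' x z ∧ ¬ b s' z x := by
      intro s' h1 h2
      have a1 := has s' h1
      have a2 := hat s' h2
      have a3 := hmod s' x z y
      have a4 := hmod s' z x y
      tauto
    rcases lt_trichotomy (rank s) (rank t) with h | h | h
    · refine ⟨t, ?_, fun s' hl => key s' (h.trans hl) hl⟩
      have a1 := has t h
      have a2 := hmod t y z x ht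
      tauto
    · obtain rfl := hinj h
      exact ⟨s, htrans s x y z hs ht, fun s' hl => key s' hl hl⟩
    · refine ⟨s, ?_, fun s' hl => key s' hl (h.trans hl)⟩
      have a1 := hat s h
      have a2 := hmod s x y z hs
      tauto
end

section
/- Let S be a finite set of sources, each s ∈ S with a belief state <^s that is a modular, transitive relation on a finite set W, and rank : S → R a rank function into a linearly ordered set R. Let ≺* = AGRRf(S) and let ≺ be the transitive closure of ≺* (i.e., ≺ = AGR(S)). Then for all x, y ∈ W: if ¬(x ≺* y) and x ≺ y, then also y ≺ x (so x and y are in conflict with respect to ≺, i.e., x ≺ y and y ≺ x). In other words, any pair newly related by the transitive-closure step of AGR is a conflicting pair. -/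
/-- `AGRRf` is modular. -/
theorem AGRRf_modular_aux {W : Type*} {S : Type*} [Fintype S]
    {R : Type*} [LinearOrder R] (b : S → W → W → Prop) (rank : S → R)
    (hmod : ∀ s, ∀ x y z : W, b s x y → b s x z ∨ b s z y)
    (x y z : W) (h : AGRRf b rank x y) : AGRRf b rank x z ∨ AGRRf b rank z y := by
  classical
  obtain ⟨s, hs, hh⟩ := h
  let T : Finset S := Finset.univ.filter fun t =>
    rank s < rank t ∧ (b t x z ∨ b t z x ∨ b t z y ∨ b t y z)
  by_cases hT : T.Nonempty
  · obtain ⟨t, ht, hmax⟩ := T.exists_max_image rank hT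
    obtain ⟨hst, hop⟩ := (Finset.mem_filter.1 ht).2
    have key : ∀ s', rank t < rank s' →
        ¬ (b s' x z ∨ b s' z x ∨ b s' z y ∨ b s' y z) := fun s' h' hc =>
      absurd (hmax s' (Finset.mem_filter.2 ⟨Finset.mem_univ _, hst.trans h', hc⟩)) (not_le.2 h')
    have h1 := hh t hst
    have h2 : b t x z ∨ b t z y := by
      have := hmod t z x y
      have := hmod t y z x
      tauto
    rcases h2 with h2 | h2
    · exact Or.inl ⟨t, h2, fun s' h' => by have := key s' h'; tauto⟩
    · exact Or.inr ⟨t, h2, fun s' h' => by have := key s' h'; tauto⟩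
  · have key : ∀ s', rank s < rank s' →
        ¬ (b s' x z ∨ b s' z x ∨ b s' z y ∨ b s' y z) := fun s' h' hc =>
      hT ⟨s', Finset.mem_filter.2 ⟨Finset.mem_univ _, h', hc⟩⟩
    rcases hmod s x y z hs with h2 | h2
    · exact Or.inl ⟨s, h2, fun s' h' => by have := key s' h'; tauto⟩
    · exact Or.inr ⟨s, h2, fun s' h' => by have := key s' h'; tauto⟩

/-- Any pair newly related by the transitive-closure step of `AGR` is a conflicting
pair: if `¬(x AGRRf y)` but `x AGR y` (where `AGR` is the transitive closure of
`AGRRf`), then also `y AGR x`. -/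
theorem AGR_new_pairs_conflict {W : Type*} [Fintype W] {S : Type*} [Fintype S]
    {R : Type*} [LinearOrder R] (b : S → W → W → Prop) (rank : S → R)
    (hmod : ∀ s, ∀ x y z : W, b s x y → b s x z ∨ b s z y)
    (htrans : ∀ s, ∀ x y z : W, b s x y → b s y z → b s x z) :
    ∀ x y : W, ¬ AGRRf b rank x y → Relation.TransGen (AGRRf b rank) x y →
      Relation.TransGen (AGRRf b rank) y x := by
  intro x y hn h
  have M := AGRRf_modular_aux b rank hmod
  obtain ⟨w, hxw, hwy⟩ := Relation.TransGen.head'_iff.1 h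
  rcases Relation.ReflTransGen.cases_tail hwy with rfl | ⟨v, hwv, hvy⟩
  · exact absurd hxw hn
  have h1 : AGRRf b rank y w := (M x w y hxw).resolve_left hn
  have h2 : AGRRf b rank v x := (M v y x hvy).resolve_right hn
  exact (Relation.TransGen.head' h1 hwv).tail h2
end
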